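/- Under stereographic projection from a point p on S^2, when a one-parameter family of immersed closed curves on S^2 passes transversally through p exactly once, the turning number of the projected planar curve changes by exactly ±2. -/

import Mathlib

noncomputable section

open Metric

/-- `n` is the turning number of the closed plane curve `γ : ℝ → ℝ²` (assumed `1`-periodic
and immersed): there is a continuous angle function for the unit tangent (Gauss) map whose
total increase over one period is `2πn`. -/
def IsTurningNumberE2 (γ : ℝ → EuclideanSpace ℝ (Fin 2)) (n : ℤ) : Prop :=
  Function.Periodic γ 1 ∧ (∀ s, deriv γ s ≠ 0) ∧
    ∃ θ : ℝ → ℝ, Continuous θ ∧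
      (∀ s : ℝ, deriv γ s 0 = ‖deriv γ s‖ * Real.cos (θ s) ∧
        deriv γ s 1 = ‖deriv γ s‖ * Real.sin (θ s)) ∧
      θ 1 = θ 0 + 2 * Real.pi * n

/-- `n` is the turning number of the stereographic projection (from the point `p ∈ S²`)
of the curve `s ↦ f (t, s)` on the sphere. -/
def TurnOfProj (p : EuclideanSpace ℝ (Fin 3)) (f : ℝ × ℝ → EuclideanSpace ℝ (Fin 3))
    (t : ℝ) (n : ℤ) : Prop :=
  ∃ (hp : p ∈ sphere (0 : EuclideanSpace ℝ (Fin 3)) 1)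
    (hm : ∀ s : ℝ, f (t, s) ∈ sphere (0 : EuclideanSpace ℝ (Fin 3)) 1),
    haveI : Fact (Module.finrank ℝ (EuclideanSpace ℝ (Fin 3)) = 2 + 1) := ⟨by simp⟩
    IsTurningNumberE2 (fun s => stereographic' 2 ⟨p, hp⟩ ⟨f (t, s), hm s⟩) n

/-- First partial derivative (in the family parameter `t`). -/
def pderiv1 (f : ℝ × ℝ → EuclideanSpace ℝ (Fin 3)) (q : ℝ × ℝ) : EuclideanSpace ℝ (Fin 3) :=
  deriv (fun u => f (u, q.2)) q.1

/-- Second partial derivative (in the curve parameter `s`). -/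
def pderiv2 (f : ℝ × ℝ → EuclideanSpace ℝ (Fin 3)) (q : ℝ × ℝ) : EuclideanSpace ℝ (Fin 3) :=
  deriv (fun u => f (q.1, u)) q.2


/-- The nowhere vanishing function `g`, restricted to `[0, 1]`, has winding number `n` around the
origin: it has a continuous argument which increases by `2πn`. -/
def HasWinding (g : ℝ → ℂ) (n : ℤ) : Prop :=
  ∃ θ : ℝ → ℝ, Continuous θ ∧
    (∀ s, ∃ r : ℝ, 0 < r ∧ g s = r * Complex.exp (θ s * Complex.I)) ∧
    θ 1 = θ 0 + 2 * Real.pi * n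

theorem eq_of_continuous_of_forall_eq_two_pi_mul_int {X : Type*} [TopologicalSpace X]
    [PreconnectedSpace X] {φ : X → ℝ} (hφ : Continuous φ)
    (hk : ∀ x, ∃ k : ℤ, φ x = 2 * Real.pi * k) (x y : X) : φ x = φ y := by
  choose k hk using hk
  have hkc : Continuous k := by
    rw [Int.isClosedEmbedding_coe_real.isInducing.continuous_iff]
    have : ((fun n : ℤ => (n : ℝ)) ∘ k) = fun x => φ x / (2 * Real.pi) := by
      funext x
      have := Real.pi_pos
      simp only [Function.comp_apply, hk]
      field_simp
    exact this ▸ hφ.div_const _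
  rw [hk, hk, PreconnectedSpace.constant ‹_› hkc (x := x) (y := y)]

namespace HasWinding

variable {g₁ g₂ : ℝ → ℂ} {n₁ n₂ : ℤ}

theorem of_exp {ℓ : ℝ → ℂ} {n : ℤ} (hℓ : Continuous ℓ)
    (hn : (ℓ 1).im = (ℓ 0).im + 2 * Real.pi * n) :
    HasWinding (fun s => Complex.exp (ℓ s)) n := by
  refine ⟨fun s => (ℓ s).im, by fun_prop, fun s => ⟨Real.exp (ℓ s).re, Real.exp_pos _, ?_⟩, hn⟩
  beta_reduce
  conv_lhs => rw [← Complex.re_add_im (ℓ s)]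
  rw [Complex.exp_add, Complex.ofReal_exp]

theorem mul (h₁ : HasWinding g₁ n₁) (h₂ : HasWinding g₂ n₂) :
    HasWinding (fun s => g₁ s * g₂ s) (n₁ + n₂) := by
  obtain ⟨θ₁, hc₁, he₁, hn₁⟩ := h₁
  obtain ⟨θ₂, hc₂, he₂, hn₂⟩ := h₂
  refine ⟨fun s => θ₁ s + θ₂ s, by fun_prop, fun s => ?_, ?_⟩
  · obtain ⟨r₁, hr₁, h₁⟩ := he₁ s
    obtain ⟨r₂, hr₂, h₂⟩ := he₂ s
    refine ⟨r₁ * r₂, by positivity, ?_⟩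
    beta_reduce
    rw [h₁, h₂]
    push_cast
    rw [add_mul, Complex.exp_add]
    ring
  · push_cast
    linarith

theorem conj (h₁ : HasWinding g₁ n₁) :
    HasWinding (fun s => (starRingEnd ℂ) (g₁ s)) (-n₁) := by
  obtain ⟨θ₁, hc₁, he₁, hn₁⟩ := h₁
  refine ⟨fun s => -θ₁ s, by fun_prop, fun s => ?_, ?_⟩
  · obtain ⟨r₁, hr₁, h₁⟩ := he₁ s
    refine ⟨r₁, hr₁, ?_⟩
    beta_reduce
    rw [h₁, map_mul, ← Complex.exp_conj]
    simp
  · push_cast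
    linarith

theorem ofReal_mul {c : ℝ → ℝ} (hc : ∀ s, 0 < c s) (h₁ : HasWinding g₁ n₁) :
    HasWinding (fun s => c s * g₁ s) n₁ := by
  obtain ⟨θ₁, hc₁, he₁, hn₁⟩ := h₁
  refine ⟨θ₁, hc₁, fun s => ?_, hn₁⟩
  obtain ⟨r₁, hr₁, h₁⟩ := he₁ s
  refine ⟨c s * r₁, mul_pos (hc s) hr₁, ?_⟩
  beta_reduce
  rw [h₁]
  push_cast
  ring

theorem unique (h₁ : HasWinding g₁ n₁) (h₂ : HasWinding g₁ n₂) : n₁ = n₂ := by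
  obtain ⟨θ₁, hc₁, he₁, hn₁⟩ := h₁
  obtain ⟨θ₂, hc₂, he₂, hn₂⟩ := h₂
  have key := eq_of_continuous_of_forall_eq_two_pi_mul_int (φ := fun s => θ₁ s - θ₂ s)
    (by fun_prop) (fun s => by
      obtain ⟨r₁, hr₁, h₁⟩ := he₁ s
      obtain ⟨r₂, hr₂, h₂⟩ := he₂ s
      have hr : r₁ = r₂ := by
        have := congrArg norm (h₁.symm.trans h₂)
        simpa [Complex.norm_exp_ofReal_mul_I, abs_of_pos hr₁, abs_of_pos hr₂] using this
      subst hr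
      have he := mul_left_cancel₀ (Complex.ofReal_ne_zero.2 hr₁.ne') (h₁.symm.trans h₂)
      obtain ⟨k, hk⟩ := Complex.exp_eq_exp_iff_exists_int.1 he
      refine ⟨k, ?_⟩
      have := congrArg Complex.im hk
      simp at this
      linarith) 0 1
  have : 2 * Real.pi * ((n₁ : ℝ) - n₂) = 0 := by linarith
  have hpi := Real.pi_ne_zero
  have : (n₁ : ℝ) - n₂ = 0 := by simpa [hpi] using this
  exact_mod_cast sub_eq_zero.1 this

/-- Homotopy invariance of the winding number. -/
theorem exists_of_continuousOn {R : ℝ × ℝ → ℂ} {a b : ℝ} (hab : a < b)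
    (hR : ContinuousOn R (Set.Ioo a b ×ˢ Set.univ)) (h₀ : ∀ t ∈ Set.Ioo a b, ∀ s, R (t, s) ≠ 0)
    (hper : ∀ t ∈ Set.Ioo a b, R (t, 1) = R (t, 0)) :
    ∃ n, ∀ t ∈ Set.Ioo a b, HasWinding (fun s => R (t, s)) n := by
  have hconv : Convex ℝ (Set.Ioo a b ×ˢ (Set.univ : Set ℝ)) := (convex_Ioo a b).prod convex_univ
  have hne : (Set.Ioo a b ×ˢ (Set.univ : Set ℝ)).Nonempty :=
    (Set.nonempty_Ioo.2 hab).prod Set.univ_nonempty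
  obtain ⟨L, hL, hexp⟩ := Complex.exists_continuousOn_eqOn_exp_comp
    (U := Set.Ioo a b ×ˢ (Set.univ : Set ℝ)) (by
      have := hconv.contractibleSpace hne
      exact SimplyConnectedSpace.ofContractible _)
    (isOpen_Ioo.prod isOpen_univ) hR (by
      rintro ⟨⟨t, s⟩, ⟨ht, -⟩, h⟩
      exact h₀ t ht s h)
  have hLc : ∀ s : ℝ, Continuous fun t : Set.Ioo a b => L (t.1, s) := fun s =>
    hL.comp_continuous (by fun_prop) fun t => ⟨t.2, trivial⟩
  have : PreconnectedSpace (Set.Ioo a b) :=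
    Subtype.preconnectedSpace isPreconnected_Ioo
  have hint : ∀ t : Set.Ioo a b, ∃ k : ℤ, (L (t.1, 1)).im - (L (t.1, 0)).im = 2 * Real.pi * k := by
    intro t
    have h1 := hexp (x := (t.1, 1)) ⟨t.2, trivial⟩
    have h0 := hexp (x := (t.1, 0)) ⟨t.2, trivial⟩
    obtain ⟨k, hk⟩ := Complex.exp_eq_exp_iff_exists_int.1 ((h1.trans (hper _ t.2)).trans h0.symm)
    refine ⟨k, ?_⟩
    have := congrArg Complex.im hk
    simp at this
    linarith
  have hconst := eq_of_continuous_of_forall_eq_two_pi_mul_int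
    ((Complex.continuous_im.comp (hLc 1)).sub (Complex.continuous_im.comp (hLc 0))) hint
  obtain ⟨t₀, ht₀⟩ := Set.nonempty_Ioo.2 hab
  obtain ⟨n, hn⟩ := hint ⟨t₀, ht₀⟩
  refine ⟨n, fun t ht => ?_⟩
  have hRL : (fun s => R (t, s)) = fun s => Complex.exp (L (t, s)) :=
    funext fun s => (hexp (x := (t, s)) ⟨ht, trivial⟩).symm
  rw [hRL]
  refine of_exp (hL.comp_continuous (by fun_prop) fun s => ⟨ht, trivial⟩) ?_
  have := hconst ⟨t, ht⟩ ⟨t₀, ht₀⟩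
  simp only [Function.comp_apply, Pi.sub_apply] at this hn
  linarith

end HasWinding

/-- A periodic model of a family of curves crossing the origin once, at time `0`. -/
def modelCrossing (κ : ℂ) (s₀ : ℝ) (q : ℝ × ℝ) : ℂ :=
  Complex.exp (2 * Real.pi * Complex.I * (q.2 - s₀)) - Complex.exp (κ * q.1)

theorem hasWinding_modelCrossing_of_neg {κ : ℂ} {s₀ t : ℝ} (h : κ.re * t < 0) :
    HasWinding (fun s => modelCrossing κ s₀ (t, s)) 1 := by
  have hslit : ∀ s : ℝ, 1 - Complex.exp (κ * t - 2 * Real.pi * Complex.I * (s - s₀)) ∈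
      Complex.slitPlane := by
    intro s
    refine Complex.mem_slitPlane_of_norm_lt_one (z := -Complex.exp _) ?_ |> fun h => by
      simpa [sub_eq_add_neg] using h
    rw [norm_neg, Complex.norm_exp, Real.exp_lt_one_iff]
    simpa using h
  have hexp : (fun s : ℝ => modelCrossing κ s₀ (t, s)) = fun s : ℝ => Complex.exp
      (2 * Real.pi * Complex.I * (s - s₀) +
        Complex.log (1 - Complex.exp (κ * t - 2 * Real.pi * Complex.I * (s - s₀)))) := by
    funext s
    rw [Complex.exp_add, Complex.exp_log (Complex.slitPlane_ne_zero (hslit s)), mul_sub, mul_one,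
      ← Complex.exp_add, modelCrossing]
    simp
  rw [hexp]
  refine HasWinding.of_exp (((by fun_prop : Continuous _)).add
    (Continuous.clog (by fun_prop) hslit)) ?_
  have : Complex.exp (κ * t - 2 * Real.pi * Complex.I * ((1 : ℝ) - s₀)) =
      Complex.exp (κ * t - 2 * Real.pi * Complex.I * ((0 : ℝ) - s₀)) := by
    rw [Complex.exp_eq_exp_iff_exists_int]
    exact ⟨-1, by push_cast; ring⟩
  rw [this]
  simp
  ring

theorem hasWinding_modelCrossing_of_pos {κ : ℂ} {s₀ t : ℝ} (h : 0 < κ.re * t) :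
    HasWinding (fun s => modelCrossing κ s₀ (t, s)) 0 := by
  have hslit : ∀ s : ℝ, 1 - Complex.exp (2 * Real.pi * Complex.I * (s - s₀) - κ * t) ∈
      Complex.slitPlane := by
    intro s
    refine Complex.mem_slitPlane_of_norm_lt_one (z := -Complex.exp _) ?_ |> fun h => by
      simpa [sub_eq_add_neg] using h
    rw [norm_neg, Complex.norm_exp, Real.exp_lt_one_iff]
    simpa using h
  have hexp : (fun s : ℝ => modelCrossing κ s₀ (t, s)) = fun s : ℝ => Complex.exp
      (κ * t + Real.pi * Complex.I +
        Complex.log (1 - Complex.exp (2 * Real.pi * Complex.I * (s - s₀) - κ * t))) := by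
    funext s
    rw [Complex.exp_add, Complex.exp_log (Complex.slitPlane_ne_zero (hslit s)), mul_sub, mul_one,
      ← Complex.exp_add, Complex.exp_add, Complex.exp_pi_mul_I, modelCrossing,
      show κ * t + Real.pi * Complex.I + (2 * Real.pi * Complex.I * (s - s₀) - κ * t) =
        2 * Real.pi * Complex.I * (s - s₀) + Real.pi * Complex.I by ring, Complex.exp_add,
      Complex.exp_pi_mul_I]
    ring
  rw [hexp]
  refine HasWinding.of_exp (((by fun_prop : Continuous _)).add
    (Continuous.clog (by fun_prop) hslit)) ?_
  have : Complex.exp (2 * Real.pi * Complex.I * ((1 : ℝ) - s₀) - κ * t) =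
      Complex.exp (2 * Real.pi * Complex.I * ((0 : ℝ) - s₀) - κ * t) := by
    rw [Complex.exp_eq_exp_iff_exists_int]
    exact ⟨1, by push_cast; ring⟩
  rw [this]
  simp

theorem modelCrossing_ne_zero {κ : ℂ} {s₀ t s : ℝ} (hκ : κ.re ≠ 0)
    (h : t = 0 → ∀ k : ℤ, s ≠ s₀ + k) : modelCrossing κ s₀ (t, s) ≠ 0 := by
  intro h0
  obtain ⟨k, hk⟩ := Complex.exp_eq_exp_iff_exists_int.1 (sub_eq_zero.1 h0)
  have hre := congrArg Complex.re hk
  simp at hre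
  have ht : t = 0 := by tauto
  have him := congrArg Complex.im hk
  refine h ht k ?_
  have hpi := Real.pi_pos
  simp [ht] at him
  have : 2 * Real.pi * (s - s₀ - k) = 0 := by linarith
  have : s - s₀ - k = 0 := by simpa [hpi.ne'] using this
  linarith

theorem modelCrossing_add_int (κ : ℂ) (s₀ t s : ℝ) (k : ℤ) :
    modelCrossing κ s₀ (t, s + k) = modelCrossing κ s₀ (t, s) := by
  unfold modelCrossing
  congr 1
  rw [Complex.exp_eq_exp_iff_exists_int]
  exact ⟨k, by push_cast; ring⟩

theorem hasFDerivAt_modelCrossing (κ : ℂ) (s₀ : ℝ) :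
    HasFDerivAt (modelCrossing κ s₀)
      ((ContinuousLinearMap.snd ℝ ℝ ℝ).smulRight (2 * Real.pi * Complex.I : ℂ) -
        (ContinuousLinearMap.fst ℝ ℝ ℝ).smulRight κ) (0, s₀) := by
  have h1 : HasFDerivAt (fun q : ℝ × ℝ => (q.2 : ℂ))
      (Complex.ofRealCLM.comp (ContinuousLinearMap.snd ℝ ℝ ℝ)) (0, s₀) :=
    (Complex.ofRealCLM.comp (ContinuousLinearMap.snd ℝ ℝ ℝ)).hasFDerivAt
  have h2 : HasFDerivAt (fun q : ℝ × ℝ => (q.1 : ℂ))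
      (Complex.ofRealCLM.comp (ContinuousLinearMap.fst ℝ ℝ ℝ)) (0, s₀) :=
    (Complex.ofRealCLM.comp (ContinuousLinearMap.fst ℝ ℝ ℝ)).hasFDerivAt
  refine (((h1.sub_const (s₀ : ℂ)).const_mul (2 * Real.pi * Complex.I)).cexp.sub
    (h2.const_mul κ).cexp).congr_fderiv ?_
  ext <;> simp [mul_comm]

open scoped ComplexConjugate RealInnerProductSpace

theorem tendsto_div_of_hasFDerivAt {E : Type*} [NormedAddCommGroup E] [NormedSpace ℝ E]
    [FiniteDimensional ℝ E] {g₁ g₂ : E → ℂ} {A : E →L[ℝ] ℂ} {x : E} {c : ℂ}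
    (h₁ : HasFDerivAt g₁ (c • A) x) (h₂ : HasFDerivAt g₂ A x) (hg₁ : g₁ x = 0) (hg₂ : g₂ x = 0)
    (hA : ∀ v, A v = 0 → v = 0) :
    Filter.Tendsto (fun z => g₁ z / g₂ z) (nhdsWithin x {x}ᶜ) (nhds c) ∧
      ∀ᶠ z in nhdsWithin x {x}ᶜ, g₂ z ≠ 0 := by
  obtain ⟨K, -, hK⟩ := (A : E →ₗ[ℝ] ℂ).exists_antilipschitzWith (LinearMap.ker_eq_bot'.2 hA)
  have hne : ∀ᶠ z in nhdsWithin x {x}ᶜ, g₂ z ≠ 0 := h₂.eventually_ne ⟨K, hK⟩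
  refine ⟨?_, hne⟩
  have hO : (fun z => z - x) =O[nhds x] g₂ := by
    have hOA : (fun z => z - x) =O[nhds x] fun z => A (z - x) :=
      Asymptotics.isBigO_iff.mpr
        ⟨K, .of_forall fun z => by simpa using hK.le_mul_dist (z - x) 0⟩
    have hequiv : Asymptotics.IsEquivalent (nhds x) (fun z => g₂ z - g₂ x) fun z => A (z - x) :=
      h₂.isLittleO.trans_isBigO hOA
    simpa [hg₂] using hOA.trans hequiv.isBigO_symm
  have ho : (fun z => g₁ z - c * g₂ z) =o[nhds x] g₂ := by
    have h := (h₁.sub (h₂.const_mul c)).isLittleO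
    simp only [sub_self, zero_apply, sub_zero] at h
    simpa [hg₁, hg₂] using h.trans_isBigO hO
  have hlim := (ho.mono nhdsWithin_le_nhds).tendsto_div_nhds_zero (l := nhdsWithin x {x}ᶜ)
  have := hlim.add_const c
  rw [zero_add] at this
  refine this.congr' ?_
  filter_upwards [hne] with z hz
  field_simp
  ring

/-- The plane coordinate in which stereographic projection from `p` is computed. -/
theorem exists_stereographic_coordinate (p : EuclideanSpace ℝ (Fin 3))
    (hp : p ∈ sphere (0 : EuclideanSpace ℝ (Fin 3)) 1) :
    ∃ Φ : EuclideanSpace ℝ (Fin 3) →L[ℝ] ℂ,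
      (∀ x z, ⟪Φ x, Φ z⟫ + ⟪p, x⟫ * ⟪p, z⟫ = ⟪x, z⟫) ∧
      ∀ x (hx : x ∈ sphere (0 : EuclideanSpace ℝ (Fin 3)) 1),
        haveI : Fact (Module.finrank ℝ (EuclideanSpace ℝ (Fin 3)) = 2 + 1) := ⟨by simp⟩
        Complex.orthonormalBasisOneI.repr.symm (stereographic' 2 ⟨p, hp⟩ ⟨x, hx⟩) =
          (2 / (1 - ⟪p, x⟫)) • Φ x := by
  have : Fact (Module.finrank ℝ (EuclideanSpace ℝ (Fin 3)) = 2 + 1) := ⟨by simp⟩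
  have hp1 : ‖p‖ = 1 := by simpa using hp
  let J : (Submodule.span ℝ {p})ᗮ ≃ₗᵢ[ℝ] ℂ :=
    (OrthonormalBasis.fromOrthogonalSpanSingleton (𝕜 := ℝ) 2
      (ne_zero_of_mem_unit_sphere (⟨p, hp⟩ : sphere (0 : EuclideanSpace ℝ (Fin 3)) 1))).repr.trans
      Complex.orthonormalBasisOneI.repr.symm
  refine ⟨(J : _ →L[ℝ] ℂ).comp (Submodule.span ℝ {p})ᗮ.orthogonalProjectionOnto, fun x z => ?_,
    fun x hx => ?_⟩
  · have hproj : ∀ x : EuclideanSpace ℝ (Fin 3),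
        ((Submodule.span ℝ {p})ᗮ.orthogonalProjectionOnto x : EuclideanSpace ℝ (Fin 3)) =
          x - ⟪p, x⟫ • p := by
      intro x
      have h := (Submodule.span ℝ {p}).starProjection_add_starProjection_orthogonal x
      rw [Submodule.starProjection_unit_singleton ℝ hp1] at h
      exact eq_sub_of_add_eq' h
    change ⟪J _, J _⟫ + _ = _
    rw [J.inner_map_map, Submodule.coe_inner]
    erw [hproj, hproj]
    simp only [inner_sub_left, inner_sub_right, inner_smul_left, inner_smul_right,
      real_inner_self_eq_norm_sq, hp1, real_inner_comm p x]
    simp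
  · change J (stereographic hp1 _) = _
    rw [stereographic_apply, map_smul]
    rfl

/-- A positive multiple of the image of the tangent vector `v` at `x` under the differential of
stereographic projection from `p`. -/
def projTangent (p : EuclideanSpace ℝ (Fin 3)) (Φ : EuclideanSpace ℝ (Fin 3) →L[ℝ] ℂ)
    (x v : EuclideanSpace ℝ (Fin 3)) : ℂ :=
  (1 - ⟪p, x⟫ : ℝ) * Φ v + (⟪p, v⟫ : ℝ) * Φ x

section

variable {p x v : EuclideanSpace ℝ (Fin 3)} {Φ : EuclideanSpace ℝ (Fin 3) →L[ℝ] ℂ}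

theorem norm_sq_projTangent (hΦ : ∀ x z, ⟪Φ x, Φ z⟫ + ⟪p, x⟫ * ⟪p, z⟫ = ⟪x, z⟫) (hx : ‖x‖ = 1)
    (hv : ⟪x, v⟫ = 0) : ‖projTangent p Φ x v‖ ^ 2 = (1 - ⟪p, x⟫) ^ 2 * ‖v‖ ^ 2 := by
  have h₁ := (hΦ x x).trans (real_inner_self_eq_norm_sq x)
  have h₂ := hΦ x v
  have h₃ := (hΦ v v).trans (real_inner_self_eq_norm_sq v)
  rw [hx] at h₁
  rw [hv] at h₂
  rw [← h₃, Complex.sq_norm, Complex.normSq_apply]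
  simp only [Complex.inner, Complex.mul_re, Complex.conj_re, Complex.conj_im] at h₁ h₂ h₃
  simp only [projTangent, Complex.inner, Complex.mul_re, Complex.mul_im, Complex.conj_re,
    Complex.conj_im, Complex.add_re, Complex.add_im, Complex.ofReal_re, Complex.ofReal_im]
  generalize ⟪p, x⟫ = h at *
  generalize ⟪p, v⟫ = k at *
  linear_combination k ^ 2 * h₁ + 2 * (1 - h) * k * h₂

theorem projTangent_mul_conj_sq (hΦ : ∀ x z, ⟪Φ x, Φ z⟫ + ⟪p, x⟫ * ⟪p, z⟫ = ⟪x, z⟫)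
    (hx : ‖x‖ = 1) (hv : ⟪x, v⟫ = 0) :
    projTangent p Φ x v * (conj (Φ x)) ^ 2 =
      -(1 - ⟪p, x⟫ : ℝ) ^ 2 * conj ((1 + ⟪p, x⟫ : ℝ) * Φ v - (⟪p, v⟫ : ℝ) * Φ x) := by
  have h₁ := (hΦ x x).trans (real_inner_self_eq_norm_sq x)
  have h₂ := hΦ x v
  rw [hx] at h₁
  rw [hv] at h₂
  have e₁ : conj (Φ x) * Φ x = 1 - (⟪p, x⟫ : ℝ) ^ 2 := by
    rw [← Complex.normSq_eq_conj_mul_self]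
    simp only [Complex.inner, Complex.mul_re, Complex.conj_re, Complex.conj_im] at h₁
    rw [Complex.normSq_apply]
    norm_cast
    linarith
  have e₂ : conj (Φ x) * Φ v + Φ x * conj (Φ v) = -(2 * (⟪p, x⟫ : ℝ) * (⟪p, v⟫ : ℝ)) := by
    have := Complex.add_conj (conj (Φ x) * Φ v)
    rw [map_mul, Complex.conj_conj] at this
    rw [this]
    rw [Complex.inner, mul_comm (Φ v)] at h₂
    norm_cast
    linarith
  simp only [projTangent, map_sub, map_mul, Complex.conj_ofReal]
  push_cast
  generalize conj (Φ x) = y' at *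
  generalize conj (Φ v) = w' at *
  generalize (⟪p, x⟫ : ℂ) = h at *
  generalize (⟪p, v⟫ : ℂ) = k at *
  linear_combination (1 - h) * y' * e₂ + (k * y' - (1 - h) * w') * e₁

theorem inner_lt_one (hp : ‖p‖ = 1) (hx : ‖x‖ = 1) (h : x ≠ p) : ⟪p, x⟫ < 1 :=
  inner_lt_one_iff_real_of_norm_eq_one hp hx |>.2 h.symm

end

theorem TurnOfProj.exists_hasWinding {p : EuclideanSpace ℝ (Fin 3)} (hp : ‖p‖ = 1) :
    ∃ Φ : EuclideanSpace ℝ (Fin 3) →L[ℝ] ℂ,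
      (∀ x z, ⟪Φ x, Φ z⟫ + ⟪p, x⟫ * ⟪p, z⟫ = ⟪x, z⟫) ∧
      ∀ (f : ℝ × ℝ → EuclideanSpace ℝ (Fin 3)) (t : ℝ) (n : ℤ), Differentiable ℝ f →
        (∀ s, f (t, s) ≠ p) → TurnOfProj p f t n →
        HasWinding (fun s => projTangent p Φ (f (t, s)) (pderiv2 f (t, s))) n := by
  have : Fact (Module.finrank ℝ (EuclideanSpace ℝ (Fin 3)) = 2 + 1) := ⟨by simp⟩
  obtain ⟨Φ, hΦ, hst⟩ := exists_stereographic_coordinate p (by simpa using hp)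
  refine ⟨Φ, hΦ, ?_⟩
  rintro f t n hf hne ⟨hp', hm, -, himm, θ, hθ, hθd, hn⟩
  refine ⟨θ, hθ, fun s => ?_, hn⟩
  have hlt : ∀ s, ⟪p, f (t, s)⟫ < 1 := fun s => inner_lt_one hp (by simpa using hm s) (hne s)
  have hpos := sub_pos.2 (hlt s)
  have hfs : HasDerivAt (fun s => f (t, s)) (pderiv2 f (t, s)) s :=
    (hf.comp (by fun_prop : Differentiable ℝ fun s : ℝ => (t, s)) s).hasDerivAt
  have hd₁ := Complex.orthonormalBasisOneI.repr.symm.toContinuousLinearEquiv.hasFDerivAt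
    |>.comp_hasDerivAt s (differentiableAt_of_deriv_ne_zero (himm s)).hasDerivAt
  have hinner : HasDerivAt (fun s => ⟪p, f (t, s)⟫) ⟪p, pderiv2 f (t, s)⟫ s :=
    (innerSL ℝ p).hasFDerivAt.comp_hasDerivAt s hfs
  have hd₂ := (((hasDerivAt_const s (2 : ℝ)).div (hinner.const_sub 1) hpos.ne').smul
    (Φ.hasFDerivAt.comp_hasDerivAt s hfs))
  have heq := hd₁.unique (hd₂.congr_of_eventuallyEq (.of_forall fun s => hst _ (hm s)))
  obtain ⟨h0, h1⟩ := hθd s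
  set w := deriv (fun s => stereographic' 2 ⟨p, hp'⟩ ⟨f (t, s), hm s⟩) s with hw
  refine ⟨‖w‖ * ((1 - ⟪p, f (t, s)⟫) ^ 2 / 2),
    mul_pos (norm_pos_iff.2 (himm s)) (by positivity), ?_⟩
  have hexp : Complex.orthonormalBasisOneI.repr.symm w = ‖w‖ * Complex.exp (θ s * Complex.I) := by
    rw [Complex.orthonormalBasisOneI_repr_symm_apply, h0, h1, Complex.exp_mul_I]
    push_cast
    ring
  have heq' : (‖w‖ : ℂ) * Complex.exp (θ s * Complex.I) = _ := hexp.symm.trans heq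
  have hc : ((1 - ⟪p, f (t, s)⟫ : ℝ) : ℂ) ≠ 0 := Complex.ofReal_ne_zero.2 hpos.ne'
  push_cast
  rw [mul_right_comm, heq']
  simp only [projTangent, Complex.real_smul, Function.comp_apply, Pi.div_apply]
  push_cast at hc ⊢
  field_simp
  ring

section

variable {f : ℝ × ℝ → EuclideanSpace ℝ (Fin 3)}

theorem inner_fderiv_eq_zero (hf : Differentiable ℝ f) (hsphere : ∀ q, ‖f q‖ = 1) (q v : ℝ × ℝ) :
    ⟪f q, fderiv ℝ f q v⟫ = 0 := by
  have h := ((hf q).hasFDerivAt.inner ℝ (hf q).hasFDerivAt).unique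
    ((hasFDerivAt_const (1 : ℝ) q).congr_of_eventuallyEq
      (.of_forall fun q => by simp [hsphere]))
  have := DFunLike.congr_fun h v
  simp [real_inner_comm (f q)] at this
  linarith

theorem pderiv1_eq_fderiv (hf : Differentiable ℝ f) (q : ℝ × ℝ) :
    pderiv1 f q = fderiv ℝ f q (1, 0) :=
  ((hf q).hasFDerivAt.comp_hasDerivAt q.1
    ((hasDerivAt_id q.1).prodMk (hasDerivAt_const q.1 q.2))).deriv

theorem pderiv2_eq_fderiv (hf : Differentiable ℝ f) (q : ℝ × ℝ) :
    pderiv2 f q = fderiv ℝ f q (0, 1) :=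
  ((hf q).hasFDerivAt.comp_hasDerivAt q.2
    ((hasDerivAt_const q.2 q.1).prodMk (hasDerivAt_id q.2))).deriv

theorem apply_add_int_of_periodic (hper : ∀ t s : ℝ, f (t, s + 1) = f (t, s)) (t s : ℝ) (k : ℤ) :
    f (t, s + k) = f (t, s) := by
  simpa using (show Function.Periodic (fun s => f (t, s)) 1 from hper t).int_mul k s

theorem pderiv2_add_int (hper : ∀ t s : ℝ, f (t, s + 1) = f (t, s)) (t s : ℝ) (k : ℤ) :
    pderiv2 f (t, s + k) = pderiv2 f (t, s) := by
  have h := deriv_comp_add_const (fun u => f (t, u)) (k : ℝ) s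
  simp only [apply_add_int_of_periodic hper] at h
  exact h.symm

end

open Classical in
/-- The tangent direction of the projected curves divided, up to positive factors, by the square of
the model crossing with parameter `κ`, extended to the crossing points, where `c` is the limit of
the quotient of the model crossing and the plane coordinate. -/
def crossingQuotient (p : EuclideanSpace ℝ (Fin 3)) (Φ : EuclideanSpace ℝ (Fin 3) →L[ℝ] ℂ)
    (f : ℝ × ℝ → EuclideanSpace ℝ (Fin 3)) (κ c : ℂ) (s₀ : ℝ) (q : ℝ × ℝ) : ℂ :=
  if f q = p then -conj (2 * Φ (pderiv2 f q)) * conj c ^ 2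
  else (((1 - ⟪p, f q⟫) ^ 2)⁻¹ : ℝ) * (projTangent p Φ (f q) (pderiv2 f q) *
    (conj (modelCrossing κ s₀ q) * conj (modelCrossing κ s₀ q)))

section

variable {p : EuclideanSpace ℝ (Fin 3)} {Φ : EuclideanSpace ℝ (Fin 3) →L[ℝ] ℂ}
  {f : ℝ × ℝ → EuclideanSpace ℝ (Fin 3)} {κ c : ℂ} {s₀ : ℝ}

theorem crossingQuotient_add_int (hper : ∀ t s : ℝ, f (t, s + 1) = f (t, s)) (t s : ℝ) (k : ℤ) :
    crossingQuotient p Φ f κ c s₀ (t, s + k) = crossingQuotient p Φ f κ c s₀ (t, s) := by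
  simp only [crossingQuotient, apply_add_int_of_periodic hper, pderiv2_add_int hper,
    modelCrossing_add_int]

theorem continuousAt_crossingQuotient_of_ne (hf : ContDiff ℝ 1 f) (hp : ‖p‖ = 1)
    (hsphere : ∀ q, ‖f q‖ = 1) {q : ℝ × ℝ} (hq : f q ≠ p) :
    ContinuousAt (crossingQuotient p Φ f κ c s₀) q := by
  have hd := hf.differentiable one_ne_zero
  have hc := hf.continuous
  have hD : Continuous (pderiv2 f) := by
    rw [funext (pderiv2_eq_fderiv hd)]
    exact (hf.continuous_fderiv one_ne_zero).clm_apply continuous_const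
  have hm : Continuous (modelCrossing κ s₀) := by
    unfold modelCrossing
    fun_prop
  have heq : crossingQuotient p Φ f κ c s₀ =ᶠ[nhds q] fun q => (((1 - ⟪p, f q⟫) ^ 2)⁻¹ : ℝ) *
      (projTangent p Φ (f q) (pderiv2 f q) *
        (conj (modelCrossing κ s₀ q) * conj (modelCrossing κ s₀ q))) := by
    filter_upwards [hc.continuousAt.eventually_ne hq] with z hz
    rw [crossingQuotient, if_neg hz]
  refine ContinuousAt.congr ?_ heq.symm
  have hne : (1 - ⟪p, f q⟫) ^ 2 ≠ 0 :=
    pow_ne_zero 2 (sub_pos.2 (inner_lt_one hp (hsphere q) hq)).ne'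
  refine ContinuousAt.mul (f := fun q => ((((1 - ⟪p, f q⟫) ^ 2)⁻¹ : ℝ) : ℂ)) ?_ ?_
  · exact Complex.continuous_ofReal.continuousAt.comp
      (ContinuousAt.inv₀ (f := fun q => (1 - ⟪p, f q⟫) ^ 2) (by fun_prop) hne)
  · unfold projTangent
    have := Complex.continuous_conj
    fun_prop

theorem continuousAt_crossingQuotient_crossing (hf : ContDiff ℝ 1 f) (hp : ‖p‖ = 1)
    (hΦ : ∀ x z, ⟪Φ x, Φ z⟫ + ⟪p, x⟫ * ⟪p, z⟫ = ⟪x, z⟫)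
    (hsphere : ∀ q, ‖f q‖ = 1) (hcross : f (0, s₀) = p)
    (hinj : ∀ v, Φ (fderiv ℝ f (0, s₀) v) = 0 → v = 0)
    (hc : c * Φ (fderiv ℝ f (0, s₀) (0, 1)) = 2 * Real.pi * Complex.I)
    (hκ : c * Φ (fderiv ℝ f (0, s₀) (1, 0)) = -κ) :
    ContinuousAt (crossingQuotient p Φ f κ c s₀) (0, s₀) := by
  have hd := hf.differentiable one_ne_zero
  have hΦp : Φ p = 0 := by
    have := hΦ p p
    simpa [real_inner_self_eq_norm_sq, hp] using this
  have hD : Continuous (pderiv2 f) := by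
    rw [funext (pderiv2_eq_fderiv hd)]
    exact (hf.continuous_fderiv one_ne_zero).clm_apply continuous_const
  have hy : HasFDerivAt (fun q => Φ (f q)) (Φ.comp (fderiv ℝ f (0, s₀))) (0, s₀) :=
    Φ.hasFDerivAt.comp _ (hd _).hasFDerivAt
  have hm : HasFDerivAt (modelCrossing κ s₀) (c • Φ.comp (fderiv ℝ f (0, s₀))) (0, s₀) := by
    refine (hasFDerivAt_modelCrossing κ s₀).congr_fderiv ?_
    ext
    · simp [hκ]
    · simp [hc]
  obtain ⟨hlim, hne⟩ := tendsto_div_of_hasFDerivAt hm hy (by simp [modelCrossing])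
    (by simp [hcross, hΦp]) hinj
  rw [continuousAt_iff_punctured_nhds]
  have hval : crossingQuotient p Φ f κ c s₀ (0, s₀) =
      -conj ((1 + ⟪p, f (0, s₀)⟫ : ℝ) * Φ (pderiv2 f (0, s₀)) -
        (⟪p, pderiv2 f (0, s₀)⟫ : ℝ) * Φ (f (0, s₀))) * conj c ^ 2 := by
    rw [crossingQuotient, if_pos hcross, hcross, real_inner_self_eq_norm_sq, hp, hΦp]
    norm_num
  rw [hval]
  have hv : Continuous fun q => (1 + ⟪p, f q⟫ : ℝ) * Φ (pderiv2 f q) -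
      (⟪p, pderiv2 f q⟫ : ℝ) * Φ (f q) := by
    have := hf.continuous
    fun_prop
  have hvlim := (Complex.continuous_conj.comp hv).neg.continuousAt (x := ((0 : ℝ), s₀)) |>.tendsto
  refine ((hvlim.mono_left nhdsWithin_le_nhds).mul
    (((Complex.continuous_conj.tendsto c).comp hlim).pow 2)).congr' ?_
  filter_upwards [hne] with q hq
  have hfq : f q ≠ p := fun h => hq (by rw [h, hΦp])
  have hpos := sub_pos.2 (inner_lt_one hp (hsphere q) hfq)
  have key := projTangent_mul_conj_sq hΦ (hsphere q)
    (pderiv2_eq_fderiv hd q ▸ inner_fderiv_eq_zero hd hsphere q (0, 1) : ⟪f q, pderiv2 f q⟫ = 0)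
  rw [crossingQuotient, if_neg hfq]
  simp only [Function.comp_apply, map_div₀, Pi.neg_apply]
  have hq' : conj (Φ (f q)) ≠ 0 := by simpa using hq
  have hh : ((1 - ⟪p, f q⟫ : ℝ) : ℂ) ≠ 0 := Complex.ofReal_ne_zero.2 hpos.ne'
  rw [Complex.ofReal_inv, Complex.ofReal_pow]
  field_simp
  linear_combination -(conj (modelCrossing κ s₀ q)) ^ 2 * key

theorem crossingQuotient_ne_zero (hf : Differentiable ℝ f) (hp : ‖p‖ = 1)
    (hΦ : ∀ x z, ⟪Φ x, Φ z⟫ + ⟪p, x⟫ * ⟪p, z⟫ = ⟪x, z⟫)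
    (hsphere : ∀ q, ‖f q‖ = 1) (hc : c ≠ 0) {q : ℝ × ℝ} (hq : pderiv2 f q ≠ 0)
    (hm : f q ≠ p → modelCrossing κ s₀ q ≠ 0) : crossingQuotient p Φ f κ c s₀ q ≠ 0 := by
  have horth : ⟪f q, pderiv2 f q⟫ = 0 :=
    pderiv2_eq_fderiv hf q ▸ inner_fderiv_eq_zero hf hsphere q (0, 1)
  rw [crossingQuotient]
  split_ifs with h
  · have h0 : Φ (pderiv2 f q) ≠ 0 := by
      intro h0
      have := hΦ (pderiv2 f q) (pderiv2 f q)
      rw [h0, ← h, horth] at this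
      simp only [inner_zero_left, mul_zero, add_zero, real_inner_self_eq_norm_sq] at this
      exact hq (by simpa using this.symm)
    simp [h0, hc]
  · have hpos := sub_pos.2 (inner_lt_one hp (hsphere q) h)
    have hu : projTangent p Φ (f q) (pderiv2 f q) ≠ 0 := by
      rw [← norm_ne_zero_iff, ← pow_ne_zero_iff two_ne_zero,
        norm_sq_projTangent hΦ (hsphere q) horth]
      have := norm_pos_iff.2 hq
      positivity
    have hm := hm h
    have hh : ((1 - ⟪p, f q⟫ : ℝ) : ℂ) ≠ 0 := Complex.ofReal_ne_zero.2 hpos.ne'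
    rw [Complex.ofReal_inv, Complex.ofReal_pow]
    simp only [ne_eq, mul_eq_zero, inv_eq_zero, pow_eq_zero_iff two_ne_zero, hh, hu, map_eq_zero,
      hm, or_self, not_false_eq_true]

end

/-- When a one-parameter family of immersed closed curves on `S²` passes transversally
through the projection point `p` exactly once, the turning number of the stereographically
projected planar curve changes by exactly `±2`. -/
theorem turning_number_jump_through_projection_point
    (f : ℝ × ℝ → EuclideanSpace ℝ (Fin 3)) (ε : ℝ) (hε : 0 < ε)
    (hsmooth : ContDiff ℝ (⊤ : ℕ∞) f)
    (hsphere : ∀ q, ‖f q‖ = 1)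
    (hper : ∀ t s : ℝ, f (t, s + 1) = f (t, s))
    (himm : ∀ t s : ℝ, deriv (fun u => f (t, u)) s ≠ 0)
    (p : EuclideanSpace ℝ (Fin 3)) (hp : ‖p‖ = 1)
    (s₀ : ℝ) (hcross : f (0, s₀) = p)
    -- `γ₀` passes through `p` at the single parameter value `s₀` (per period):
    (huniq : ∀ s ∈ Set.Ico s₀ (s₀ + 1), f (0, s) = p → s = s₀)
    -- the family crosses `p` transversally at `(0, s₀)`:
    (htrans : ¬ ∃ a : ℝ, pderiv1 f (0, s₀) = a • pderiv2 f (0, s₀))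
    -- the curves avoid `p` for `t ≠ 0`:
    (havoid : ∀ t : ℝ, t ≠ 0 → |t| < ε → ∀ s : ℝ, f (t, s) ≠ p) :
    ∀ t₁ ∈ Set.Ioo (-ε) (0:ℝ), ∀ t₂ ∈ Set.Ioo (0:ℝ) ε,
      ∀ n₁ n₂ : ℤ, TurnOfProj p f t₁ n₁ → TurnOfProj p f t₂ n₂ →
        n₂ - n₁ = 2 ∨ n₂ - n₁ = -2 := by
  have hf : ContDiff ℝ 1 f := hsmooth.of_le (by exact_mod_cast le_top)
  have hd : Differentiable ℝ f := hf.differentiable one_ne_zero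
  obtain ⟨Φ, hΦ, hturn⟩ := TurnOfProj.exists_hasWinding hp
  have hD : ∀ q, pderiv2 f q ≠ 0 := fun q => himm q.1 q.2
  have hinj : ∀ v, Φ (fderiv ℝ f (0, s₀) v) = 0 → v = 0 := by
    rintro ⟨x, y⟩ hv
    have horth := inner_fderiv_eq_zero hd hsphere (0, s₀) (x, y)
    have h := hΦ (fderiv ℝ f (0, s₀) (x, y)) (fderiv ℝ f (0, s₀) (x, y))
    rw [hv, ← hcross, horth] at h
    have hz : fderiv ℝ f (0, s₀) (x, y) = 0 := by simpa using h.symm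
    have hsplit : x • pderiv1 f (0, s₀) + y • pderiv2 f (0, s₀) = 0 := by
      rw [pderiv1_eq_fderiv hd, pderiv2_eq_fderiv hd, ← map_smul, ← map_smul, ← map_add]
      simpa using hz
    have hx : x = 0 := by
      by_contra hx
      refine htrans ⟨-(x⁻¹ * y), ?_⟩
      rw [neg_smul, mul_smul, ← smul_neg, ← eq_neg_of_add_eq_zero_left hsplit, inv_smul_smul₀ hx]
    have hy : y = 0 := by simpa [hx, hD] using hsplit
    rw [hx, hy, Prod.mk_zero_zero]
  set a := Φ (fderiv ℝ f (0, s₀) (1, 0)) with ha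
  set b := Φ (fderiv ℝ f (0, s₀) (0, 1)) with hb
  have hb0 : b ≠ 0 := fun h => by simpa using hinj (0, 1) h
  have hpi := Real.pi_pos
  set c : ℂ := 2 * Real.pi * Complex.I / b with hc
  have hc0 : c ≠ 0 := div_ne_zero Complex.two_pi_I_ne_zero hb0
  set κ : ℂ := -(c * a) with hκ
  have hκre : κ.re ≠ 0 := by
    intro h
    have him : (a / b).im = 0 := by
      have h' : κ = (2 * Real.pi : ℝ) * (-(Complex.I * (a / b))) := by
        rw [hκ, hc]
        push_cast
        ring
      rw [h', Complex.re_ofReal_mul] at h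
      simpa [hpi.ne'] using h
    have hab : a = (a / b).re * b := by
      rw [← div_eq_iff hb0]
      exact Complex.ext (by simp) (by simp [him])
    have h0 : Φ (fderiv ℝ f (0, s₀) ((1, 0) - (a / b).re • (0, 1))) = 0 := by
      rw [map_sub, map_sub, map_smul, map_smul, ← ha, ← hb, Complex.real_smul, ← hab, sub_self]
    simpa using congrArg Prod.fst (hinj _ h0)
  have hzero : ∀ s, f (0, s) = p → ∃ k : ℤ, s = s₀ + k := by
    intro s hs
    refine ⟨⌊s - s₀⌋, ?_⟩
    have h := huniq (s + (-⌊s - s₀⌋ : ℤ)) ?_ ((apply_add_int_of_periodic hper _ _ _).trans hs)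
    · push_cast at h
      linarith
    · have h1 := Int.floor_le (s - s₀)
      have h2 := Int.lt_floor_add_one (s - s₀)
      push_cast
      constructor <;> linarith
  have hcont : ContinuousOn (crossingQuotient p Φ f κ c s₀) (Set.Ioo (-ε) ε ×ˢ Set.univ) := by
    rintro ⟨t, s⟩ ⟨ht, -⟩
    apply ContinuousAt.continuousWithinAt
    by_cases hq : f (t, s) = p
    · have ht0 : t = 0 := by
        by_contra ht0
        exact havoid t ht0 (abs_lt.2 ht) s hq
      subst ht0
      obtain ⟨k, rfl⟩ := hzero s hq
      have hshift : crossingQuotient p Φ f κ c s₀ =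
          crossingQuotient p Φ f κ c s₀ ∘ fun q => (q.1, q.2 - k) := by
        funext q
        have := crossingQuotient_add_int (p := p) (Φ := Φ) (κ := κ) (c := c) (s₀ := s₀) hper
          q.1 (q.2 - k) k
        simpa using this
      rw [hshift]
      refine ContinuousAt.comp ?_ (by fun_prop)
      simp only [add_sub_cancel_right]
      exact continuousAt_crossingQuotient_crossing hf hp hΦ hsphere hcross hinj
        (div_mul_cancel₀ _ hb0) (neg_neg (c * a)).symm
    · exact continuousAt_crossingQuotient_of_ne hf hp hsphere hq
  have hne : ∀ t ∈ Set.Ioo (-ε) ε, ∀ s, crossingQuotient p Φ f κ c s₀ (t, s) ≠ 0 := by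
    intro t _ s
    refine crossingQuotient_ne_zero hd hp hΦ hsphere hc0 (hD _) fun hq =>
      modelCrossing_ne_zero hκre ?_
    rintro rfl k rfl
    exact hq ((apply_add_int_of_periodic hper _ _ _).trans hcross)
  obtain ⟨n, hn⟩ := HasWinding.exists_of_continuousOn (neg_lt_self hε) hcont hne fun t _ => by
    simpa using crossingQuotient_add_int (p := p) (Φ := Φ) (κ := κ) (c := c) (s₀ := s₀) hper t 0 1
  have hcount : ∀ t, t ≠ 0 → |t| < ε → ∀ m d : ℤ, TurnOfProj p f t m →
      HasWinding (fun s => modelCrossing κ s₀ (t, s)) d → m + (-d + -d) = n := by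
    intro t ht0 ht m d hm hmodel
    have hfp := havoid t ht0 ht
    have hw := ((hturn f t m hd hfp hm).mul (hmodel.conj.mul hmodel.conj)).ofReal_mul
      (c := fun s => ((1 - ⟪p, f (t, s)⟫) ^ 2)⁻¹) fun s => by
        have := sub_pos.2 (inner_lt_one hp (hsphere (t, s)) (hfp s))
        positivity
    refine hw.unique ?_
    have := hn t (abs_lt.1 ht)
    simpa only [crossingQuotient, if_neg (hfp _)] using this
  intro t₁ ht₁ t₂ ht₂ n₁ n₂ h₁ h₂
  have hc₁ := hcount t₁ ht₁.2.ne (abs_lt.2 ⟨ht₁.1, ht₁.2.trans hε⟩) n₁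
  have hc₂ := hcount t₂ ht₂.1.ne' (abs_lt.2 ⟨by linarith [ht₂.1], ht₂.2⟩) n₂
  rcases hκre.lt_or_gt with hneg | hpos
  · have e₁ := hc₁ 0 h₁ (hasWinding_modelCrossing_of_pos (mul_pos_of_neg_of_neg hneg ht₁.2))
    have e₂ := hc₂ 1 h₂ (hasWinding_modelCrossing_of_neg (mul_neg_of_neg_of_pos hneg ht₂.1))
    omega
  · have e₁ := hc₁ 1 h₁ (hasWinding_modelCrossing_of_neg (mul_neg_of_pos_of_neg hpos ht₁.2))
    have e₂ := hc₂ 0 h₂ (hasWinding_modelCrossing_of_pos (mul_pos hpos ht₂.1))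
    omega
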